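/- Let Δ₂, Δ₃ be finite sets each of cardinality at least 2. Then d(C₂ ≀_{Δ₂×Δ₃} (Sym(Δ₂) × Sym(Δ₃))) = 3, where Sym(Δ₂) × Sym(Δ₃) acts on the index set Δ₂ × Δ₃ componentwise: (g, h) • (δ₂, δ₃) = (g(δ₂), h(δ₃)). -/

import Mathlib

/-- minimal number of generators of a group -/
noncomputable def d (G : Type*) [Group G] : ℕ :=
  sInf {n | ∃ S : Finset G, S.card = n ∧ Subgroup.closure (S : Set G) = ⊤}

/-- the coordinate-permuting action of `G` on `X → H`, where `G` acts on `X` via `ρ`. -/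
def wrAction (H : Type*) [Group H] {X G : Type*} [Group G]
    (ρ : G →* Equiv.Perm X) : G →* MulAut (X → H) where
  toFun g :=
    { toFun := fun f x => f ((ρ g)⁻¹ x)
      invFun := fun f x => f (ρ g x)
      left_inv := fun f => funext fun x => by simp
      right_inv := fun f => funext fun x => by simp
      map_mul' := fun f₁ f₂ => rfl }
  map_one' := by ext f x; simp
  map_mul' := fun g₁ g₂ => by ext f x; simp [mul_inv_rev]

/-- The wreath product `H ≀_X G`, where `G` acts on `X` via `ρ`. -/
abbrev Wr (H : Type*) [Group H] {X G : Type*} [Group G] (ρ : G →* Equiv.Perm X) : Type _ :=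
  SemidirectProduct (X → H) G (wrAction H ρ)

/-- `C₂`, the cyclic group of order 2. -/
abbrev C2 : Type := Multiplicative (ZMod 2)

/-- the componentwise action `(g, h) • (δ₂, δ₃) = (g δ₂, h δ₃)` as a homomorphism. -/
def prodPermHom (α β : Type*) : Equiv.Perm α × Equiv.Perm β →* Equiv.Perm (α × β) where
  toFun p := Equiv.prodCongr p.1 p.2
  map_one' := Equiv.ext fun _ => rfl
  map_mul' := fun _ _ => Equiv.ext fun _ => rfl

/-- The isomorphism from `ℤˣ` to `C2`, as a homomorphism. -/
def unitsToC2 : ℤˣ →* C2 where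
  toFun u := Multiplicative.ofAdd (if u = 1 then 0 else 1)
  map_one' := by decide
  map_mul' := by decide

/-- The symmetric group on a finite set with at least two elements is generated by an element of
odd order and an involution. -/
theorem exists_odd_pow_involution_closure (α : Type*) [Fintype α] (h : 2 ≤ Fintype.card α) :
    ∃ (σ τ : Equiv.Perm α) (k : ℕ), σ ^ (2 * k + 1) = 1 ∧ τ ^ 2 = 1 ∧
      Subgroup.closure {σ, τ} = ⊤ := by
  classical
  rcases Nat.even_or_odd (Fintype.card α) with he | ho
  · obtain ⟨p, q, hpq⟩ := Fintype.one_lt_card_iff.1 h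
    obtain ⟨σ, hσ, hsupp⟩ := (Finset.univ.erase p).exists_cycleOn
    have hp : σ p = p := by
      by_contra hne
      simpa using hsupp (Equiv.Perm.mem_support.2 hne)
    obtain ⟨k, hk⟩ : ∃ k, (Finset.univ.erase p).card = 2 * k + 1 := by
      obtain ⟨j, hj⟩ := he
      refine ⟨j - 1, ?_⟩
      rw [Finset.card_erase_of_mem (Finset.mem_univ p), Finset.card_univ]
      omega
    refine ⟨σ, Equiv.swap p q, k, ?_, by simp [sq], ?_⟩
    · ext x
      by_cases hx : x = p
      · rw [hx, Equiv.Perm.pow_apply_eq_self_of_apply_eq_self hp, Equiv.Perm.one_apply]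
      · rw [← hk, hσ.pow_card_apply (by simpa using hx), Equiv.Perm.one_apply]
    · set H := Subgroup.closure {σ, Equiv.swap p q} with hH
      have hσH : σ ∈ H := Subgroup.subset_closure (by simp)
      have hτH : Equiv.swap p q ∈ H := Subgroup.subset_closure (by simp)
      have star (x : α) : Equiv.swap p x ∈ H := by
        by_cases hx : x = p
        · simp [hx, ← Equiv.Perm.one_def, H.one_mem]
        obtain ⟨i, hi⟩ := hσ.2 (x := q) (y := x) (by simpa using hpq.symm) (by simpa using hx)
        have := H.mul_mem (H.mul_mem (H.zpow_mem hσH i) hτH) (H.inv_mem (H.zpow_mem hσH i))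
        rwa [← Equiv.swap_apply_apply,
          Equiv.Perm.zpow_apply_eq_self_of_apply_eq_self hp, hi] at this
      rw [eq_top_iff, ← Equiv.Perm.closure_isSwap, Subgroup.closure_le]
      rintro _ ⟨x, y, hxy, rfl⟩
      by_cases hx : x = p
      · exact hx ▸ star y
      by_cases hy : y = p
      · rw [Equiv.swap_comm]; exact hy ▸ star x
      have := H.mul_mem (H.mul_mem (star x) (star y)) (H.inv_mem (star x))
      rwa [← Equiv.swap_apply_apply, Equiv.swap_apply_left,
        Equiv.swap_apply_of_ne_of_ne hy hxy.symm] at this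
  · obtain ⟨σ, hσ, -⟩ := (Finset.univ : Finset α).exists_cycleOn
    have : Nontrivial α := Fintype.one_lt_card_iff_nontrivial.1 h
    obtain ⟨k, hk⟩ := ho
    obtain ⟨q⟩ : Nonempty α := inferInstance
    have hne (x : α) : σ x ≠ x :=
      hσ.apply_ne (by simpa using Set.nontrivial_univ) (by simp)
    have hsupp : σ.support = Finset.univ := by
      ext x; simpa using hne x
    have hc : σ.IsCycle := ⟨q, hne q, fun y _ => hσ.2 (by simp) (by simp)⟩
    refine ⟨σ, Equiv.swap q (σ q), k, ?_, by simp [sq],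
      Equiv.Perm.closure_cycle_adjacent_swap hc hsupp q⟩
    ext x
    rw [← hk, ← Finset.card_univ, hσ.pow_card_apply (by simp), Equiv.Perm.one_apply]

/-- If `G` and `H` are each generated by an element of odd order together with an involution,
then `G × H` is generated by two elements. -/
theorem closure_pair_prod_eq_top {G H : Type*} [Group G] [Group H] {σ τ : G} {σ' τ' : H}
    {k k' : ℕ} (hσ : σ ^ (2 * k + 1) = 1) (hτ : τ ^ 2 = 1) (hG : Subgroup.closure {σ, τ} = ⊤)
    (hσ' : σ' ^ (2 * k' + 1) = 1) (hτ' : τ' ^ 2 = 1) (hH : Subgroup.closure {σ', τ'} = ⊤) :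
    Subgroup.closure {((σ, τ') : G × H), (τ, σ')} = ⊤ := by
  set K := Subgroup.closure {((σ, τ') : G × H), (τ, σ')}
  have hx : (σ, τ') ∈ K := Subgroup.subset_closure (by simp)
  have hy : (τ, σ') ∈ K := Subgroup.subset_closure (by simp)
  have hτ'K : ((1, τ') : G × H) ∈ K := by
    have := K.pow_mem hx (2 * k + 1)
    rwa [Prod.pow_mk, hσ, pow_succ, pow_mul, hτ', one_pow, one_mul] at this
  have hτK : ((τ, 1) : G × H) ∈ K := by
    have := K.pow_mem hy (2 * k' + 1)
    rwa [Prod.pow_mk, hσ', pow_succ, pow_mul, hτ, one_pow, one_mul] at this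
  have hσK : ((σ, 1) : G × H) ∈ K := by
    simpa using K.mul_mem hx (K.inv_mem hτ'K)
  have hσ'K : ((1, σ') : G × H) ∈ K := by
    simpa using K.mul_mem hy (K.inv_mem hτK)
  have hl : ⊤ ≤ K.comap (MonoidHom.inl G H) := by
    rw [← hG, Subgroup.closure_le]
    rintro _ (rfl | rfl)
    exacts [hσK, hτK]
  have hr : ⊤ ≤ K.comap (MonoidHom.inr G H) := by
    rw [← hH, Subgroup.closure_le]
    rintro _ (rfl | rfl)
    exacts [hσ'K, hτ'K]
  refine eq_top_iff.2 fun ⟨g, h⟩ _ => ?_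
  simpa using K.mul_mem (hl (Subgroup.mem_top g)) (hr (Subgroup.mem_top h))

theorem wrAction_mulSingle {H X G : Type*} [Group H] [Group G] [DecidableEq X]
    (ρ : G →* Equiv.Perm X) (g : G) (x : X) (t : H) :
    wrAction H ρ g (Pi.mulSingle x t) = Pi.mulSingle (ρ g x) t := by
  funext y
  change (Pi.mulSingle x t : X → H) ((ρ g)⁻¹ y) = _
  simp only [Pi.mulSingle_apply, Equiv.Perm.inv_eq_iff_eq]

/-- For a transitive action, lifts of generators of `G` and one function supported at a point
with value a generator of `C₂` generate `C₂ ≀ G`. -/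
theorem wr_closure_eq_top {X G : Type*} [Group G] [Finite X] [DecidableEq X]
    (ρ : G →* Equiv.Perm X) (x : X) (htrans : ∀ y, ∃ g, ρ g x = y) {a b : G}
    (hG : Subgroup.closure {a, b} = ⊤) :
    Subgroup.closure {(SemidirectProduct.inr a : Wr C2 ρ), SemidirectProduct.inr b,
      SemidirectProduct.inl (Pi.mulSingle x (Multiplicative.ofAdd 1))} = ⊤ := by
  set K := Subgroup.closure {(SemidirectProduct.inr a : Wr C2 ρ), SemidirectProduct.inr b,
      SemidirectProduct.inl (Pi.mulSingle x (Multiplicative.ofAdd 1))}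
  have hr (g : G) : (SemidirectProduct.inr g : Wr C2 ρ) ∈ K := by
    have hle : ⊤ ≤ K.comap (SemidirectProduct.inr : G →* Wr C2 ρ) := by
      rw [← hG, Subgroup.closure_le]
      rintro _ (rfl | rfl) <;> exact Subgroup.subset_closure (by simp)
    exact hle (Subgroup.mem_top g)
  have hsingle (y : X) (t : C2) :
      (SemidirectProduct.inl (Pi.mulSingle y t) : Wr C2 ρ) ∈ K := by
    obtain rfl | rfl : t = 1 ∨ t = Multiplicative.ofAdd 1 := by revert t; decide
    · simp [K.one_mem]
    · obtain ⟨g, rfl⟩ := htrans y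
      rw [← wrAction_mulSingle, SemidirectProduct.inl_aut]
      exact K.mul_mem (K.mul_mem (hr g) (Subgroup.subset_closure (by simp))) (hr g⁻¹)
  refine eq_top_iff.2 fun w _ => ?_
  rw [← SemidirectProduct.inl_left_mul_inr_right w]
  exact K.mul_mem
    (Subgroup.pi_mem_of_mulSingle_mem (H := K.comap SemidirectProduct.inl) w.left
      fun y => hsingle y _) (hr w.right)

/-- A group mapping onto an elementary abelian group of order `2 ^ n` needs at least `n`
generators. -/
theorem le_card_of_surjective_of_closure_eq_top {G : Type*} [Group G] {n : ℕ}
    (φ : G →* Multiplicative (Fin n → ZMod 2)) (hφ : Function.Surjective φ) {S : Finset G}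
    (hS : Subgroup.closure (S : Set G) = ⊤) : n ≤ S.card := by
  classical
  let T : Finset (Fin n → ZMod 2) := S.image fun s => Multiplicative.toAdd (φ s)
  let V : Submodule (ZMod 2) (Fin n → ZMod 2) := Submodule.span (ZMod 2) T
  have hle : ⊤ ≤ (AddSubgroup.toSubgroup V.toAddSubgroup).comap φ := by
    rw [← hS, Subgroup.closure_le]
    exact fun s hs => Submodule.subset_span (Finset.mem_coe.2 (Finset.mem_image_of_mem _ hs))
  have hV : V = ⊤ := by
    refine eq_top_iff.2 fun v _ => ?_
    obtain ⟨g, hg⟩ := hφ (Multiplicative.ofAdd v)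
    have : φ g ∈ AddSubgroup.toSubgroup V.toAddSubgroup := hle (Subgroup.mem_top g)
    rw [hg] at this
    exact this
  calc n = Module.finrank (ZMod 2) V := by rw [hV, finrank_top, Module.finrank_fin_fun]
    _ ≤ T.card := finrank_span_finset_le_card T
    _ ≤ S.card := Finset.card_image_le

/-- The homomorphism from `C₂ ≀ (Sym α × Sym β)` recording the product of the coordinates and the
two signs. -/
def wrToC2Cube (α β : Type*) [Fintype α] [Fintype β] [DecidableEq α] [DecidableEq β] :
    Wr C2 (prodPermHom α β) →* Multiplicative (Fin 3 → ZMod 2) :=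
  MonoidHom.mk' (fun w => Multiplicative.ofAdd
    ![Multiplicative.toAdd (∏ x, w.left x),
      Multiplicative.toAdd (unitsToC2 (Equiv.Perm.sign w.right.1)),
      Multiplicative.toAdd (unitsToC2 (Equiv.Perm.sign w.right.2))]) <| by
    intro v w
    have h : ∏ x, wrAction C2 (prodPermHom α β) v.right w.left x = ∏ x, w.left x :=
      Equiv.prod_comp (prodPermHom α β v.right)⁻¹ w.left
    rw [← ofAdd_add]
    congr 1
    funext i
    fin_cases i <;> simp [Finset.prod_mul_distrib, h, -toAdd_prod]

theorem wrToC2Cube_surjective (α β : Type*) [Fintype α] [Fintype β] [DecidableEq α]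
    [DecidableEq β] [Nontrivial α] [Nontrivial β] :
    Function.Surjective (wrToC2Cube α β) := by
  obtain ⟨x⟩ : Nonempty (α × β) := inferInstance
  have hu : Function.Surjective unitsToC2 := by decide
  intro v
  obtain ⟨g, hg⟩ :=
    (hu.comp (Equiv.Perm.sign_surjective α)) (Multiplicative.ofAdd (Multiplicative.toAdd v 1))
  obtain ⟨h, hh⟩ :=
    (hu.comp (Equiv.Perm.sign_surjective β)) (Multiplicative.ofAdd (Multiplicative.toAdd v 2))
  simp only [Function.comp_apply] at hg hh
  refine ⟨⟨Pi.mulSingle x (Multiplicative.ofAdd (Multiplicative.toAdd v 0)), (g, h)⟩, ?_⟩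
  apply Multiplicative.toAdd.injective
  funext i
  fin_cases i <;> simp [wrToC2Cube, hg, hh, -toAdd_prod]

theorem stmt_6 {Δ₂ Δ₃ : Type*} [Fintype Δ₂] [Fintype Δ₃]
    (h2 : 2 ≤ Fintype.card Δ₂) (h3 : 2 ≤ Fintype.card Δ₃) :
    d (Wr C2 (prodPermHom Δ₂ Δ₃)) = 3 := by
  classical
  have : Nontrivial Δ₂ := Fintype.one_lt_card_iff_nontrivial.1 h2
  have : Nontrivial Δ₃ := Fintype.one_lt_card_iff_nontrivial.1 h3
  obtain ⟨σ, τ, k, hσ, hτ, hG⟩ := exists_odd_pow_involution_closure Δ₂ h2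
  obtain ⟨σ', τ', k', hσ', hτ', hH⟩ := exists_odd_pow_involution_closure Δ₃ h3
  obtain ⟨x⟩ : Nonempty (Δ₂ × Δ₃) := inferInstance
  have htrans (y : Δ₂ × Δ₃) : ∃ g, prodPermHom Δ₂ Δ₃ g x = y :=
    ⟨(Equiv.swap x.1 y.1, Equiv.swap x.2 y.2), by
      simp [prodPermHom, Prod.map]⟩
  have hgen := wr_closure_eq_top (prodPermHom Δ₂ Δ₃) x htrans
    (closure_pair_prod_eq_top hσ hτ hG hσ' hτ' hH)
  have hexists : ∃ S : Finset (Wr C2 (prodPermHom Δ₂ Δ₃)), S.card ≤ 3 ∧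
      Subgroup.closure (S : Set (Wr C2 (prodPermHom Δ₂ Δ₃))) = ⊤ :=
    ⟨{_, _, _}, Finset.card_le_three, by simpa using hgen⟩
  obtain ⟨S, hcard, hS⟩ := hexists
  have hle : d (Wr C2 (prodPermHom Δ₂ Δ₃)) ≤ S.card := Nat.sInf_le ⟨S, rfl, hS⟩
  refine le_antisymm (hle.trans hcard) (le_csInf ⟨_, S, rfl, hS⟩ ?_)
  rintro n ⟨T, rfl, hT⟩
  exact le_card_of_surjective_of_closure_eq_top _ (wrToC2Cube_surjective Δ₂ Δ₃) hT
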